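/- Let k be a field, G a finite group, X a set of representatives of the conjugacy classes of G, and n ≥ 0. For each x ∈ X, ν^n_{G,x} maps CS^n(C_G(x), kx) into CS^n(kG,kG) and π^n_{G,x} maps CS^n(kG,kG) into CS^n(C_G(x), kx), inducing maps ν^{n,S}_{G,x} : HS^n(C_G(x), k) → HHS^n(kG) and π^{n,S}_{G,x} : HHS^n(kG) → HS^n(C_G(x), k) (identifying kx with the trivial module k). Moreover ⊕_{x∈X} ν^{n,S}_{G,x} : ⊕_{x∈X} HS^n(C_G(x), k) → HHS^n(kG) is injective and admits ⊕_{x∈X} π^{n,S}_{G,x} : HHS^n(kG) → ⊕_{x∈X} HS^n(C_G(x), k) as a left inverse (which is therefore surjective). -/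

import Mathlib

/- Common setup: twisted group algebras modelled on their canonical basis.
An element of the twisted group algebra `k_αG` is modelled as a function `G → k`
(its coordinates in the basis `{ḡ : g ∈ G}`), and a Hochschild `n`-cochain
`Hom_k((k_αG)^{⊗n}, M)` is modelled by its values on basis tensors, i.e. as a
function `(Fin n → G) → M`.  Similarly a group cochain `C^n(H, A)` is a function
`(Fin n → H) → A`; the one-dimensional module `k x̄` is modelled as `k` with the
action of `h` given by multiplication by the character `χ(h) = α(h,x)·α(x,h)⁻¹`. -/

namespace TwistedSym

section Defs

variable {k : Type*} [CommRing k] {G : Type*} [Group G] [DecidableEq G]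
variable {M : Type*} [AddCommGroup M] [Module k M]
variable {H : Type*} [Group H]
variable {A : Type*} [AddCommGroup A] [DistribMulAction H A]

/-- The 2-cocycle condition `α(x,yz)α(y,z) = α(xy,z)α(x,y)`. -/
def IsCocycle (α : G → G → kˣ) : Prop :=
  ∀ x y z : G, α x (y * z) * α y z = α (x * y) z * α x y

/-- Normalization `α(1,x) = α(x,1) = 1`. -/
def IsNormalized (α : G → G → kˣ) : Prop :=
  ∀ x : G, α 1 x = 1 ∧ α x 1 = 1

/-- `(L, R)` encode a `(k_αG, k_αG)`-bimodule structure on the `k`-module `M`: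
`L g` is left multiplication by the basis element `ḡ` and `R g` is right
multiplication by `ḡ`. -/
def IsBimodule (α : G → G → kˣ) (L R : G → M →ₗ[k] M) : Prop :=
  (∀ m : M, L 1 m = m) ∧ (∀ m : M, R 1 m = m) ∧
  (∀ (g h : G) (m : M), L g (L h m) = (α g h : k) • L (g * h) m) ∧
  (∀ (g h : G) (m : M), R h (R g m) = (α g h : k) • R (g * h) m) ∧
  (∀ (g h : G) (m : M), L g (R h m) = R h (L g m))

/-- The tuple of group elements appearing in the action of the transposition
`σ_{i0+1} = (i0+1, i0+2)` on `n`-cochains (0-indexed `i0 : Fin n`):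
position `i0 - 1` gets `g_{i0-1}·g_{i0}`, position `i0` gets `g_{i0}⁻¹` and
position `i0 + 1` gets `g_{i0}·g_{i0+1}` (when these positions exist). -/
def swapTuple {n : ℕ} (i0 : Fin n) (g : Fin n → H) : Fin n → H := fun j =>
  if (j : ℕ) + 1 = (i0 : ℕ) then g j * g i0
  else if j = i0 then (g i0)⁻¹
  else if (j : ℕ) = (i0 : ℕ) + 1 then g i0 * g j
  else g j

/-- The action of the transposition `σ_{i0+1} = (i0+1,i0+2) ∈ Σ_{n+1}` on Hochschild
`n`-cochains of the twisted group algebra `k_αG` with coefficients in the bimodule `M`.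
All the `α`-scalars come from rewriting products and inverses of basis elements in
terms of basis elements: `ḡ·h̄ = α(g,h)·(gh)‾` and `ḡ⁻¹ = α(g,g⁻¹)⁻¹·(g⁻¹)‾`. -/
def hSigma (α : G → G → kˣ) (L R : G → M →ₗ[k] M) {n : ℕ} (i0 : Fin n)
    (φ : (Fin n → G) → M) : (Fin n → G) → M := fun g =>
  -(((if 0 < (i0 : ℕ) then
        (α (g ⟨(i0 : ℕ) - 1, lt_of_le_of_lt (Nat.sub_le _ _) i0.isLt⟩) (g i0) : k) else 1) *
     (((α (g i0) (g i0)⁻¹)⁻¹ : kˣ) : k) *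
     (if h : (i0 : ℕ) + 1 < n then (α (g i0) (g ⟨(i0 : ℕ) + 1, h⟩) : k) else 1)) •
    (if (i0 : ℕ) = 0 then
        L (g i0) (if (i0 : ℕ) + 1 = n then R (g i0) (φ (swapTuple i0 g)) else φ (swapTuple i0 g))
      else (if (i0 : ℕ) + 1 = n then R (g i0) (φ (swapTuple i0 g)) else φ (swapTuple i0 g))))

/-- Staic's action of the transposition `σ_{i0+1} ∈ Σ_{n+1}` on group `n`-cochains
with values in an `H`-module `A`. -/
def gSigma {n : ℕ} (i0 : Fin n) (ψ : (Fin n → H) → A) : (Fin n → H) → A := fun h =>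
  -(if (i0 : ℕ) = 0 then h i0 • ψ (swapTuple i0 h) else ψ (swapTuple i0 h))

/-- Staic's action of the transposition `σ_{i0+1} ∈ Σ_{n+1}` on group `n`-cochains
with values in the rank-one module `k` on which `H` acts through the character `χ`. -/
def cSigma (χ : H → k) {n : ℕ} (i0 : Fin n) (ψ : (Fin n → H) → k) : (Fin n → H) → k := fun h =>
  -(if (i0 : ℕ) = 0 then χ (h i0) * ψ (swapTuple i0 h) else ψ (swapTuple i0 h))

/-- The `(n+1)`-tuple `g` with entries at positions `j, j+1` multiplied together. -/
def mergeAt {n : ℕ} (g : Fin (n + 1) → H) (j : Fin n) : Fin n → H := fun l =>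
  if (l : ℕ) < (j : ℕ) then g (Fin.castSucc l)
  else if l = j then g (Fin.castSucc l) * g (Fin.succ l)
  else g (Fin.succ l)

/-- The Hochschild differential `δ^n` for the twisted group algebra `k_αG` with
coefficients in the bimodule `M`, written on basis tensors (the scalar
`α(g_j, g_{j+1})` comes from `ḡ_j·ḡ_{j+1} = α(g_j,g_{j+1})·(g_jg_{j+1})‾`). -/
def hDiff (α : G → G → kˣ) (L R : G → M →ₗ[k] M) {n : ℕ}
    (φ : (Fin n → G) → M) : (Fin (n + 1) → G) → M := fun g =>
  L (g 0) (φ fun j => g j.succ)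
    + ∑ j : Fin n, ((-1 : ℤ) ^ ((j : ℕ) + 1)) •
        ((α (g j.castSucc) (g j.succ) : k) • φ (mergeAt g j))
    + ((-1 : ℤ) ^ (n + 1)) • R (g (Fin.last n)) (φ fun j => g j.castSucc)

/-- The group cohomology differential `∂^n` for cochains on `H` with values in the
`H`-module `A`. -/
def gDiff {n : ℕ} (ψ : (Fin n → H) → A) : (Fin (n + 1) → H) → A := fun h =>
  h 0 • ψ (fun j => h j.succ)
    + ∑ j : Fin n, ((-1 : ℤ) ^ ((j : ℕ) + 1)) • ψ (mergeAt h j)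
    + ((-1 : ℤ) ^ (n + 1)) • ψ (fun j => h j.castSucc)

/-- The group cohomology differential `∂^n` for cochains on `H` with values in the
rank-one module `k` on which `H` acts through the character `χ`. -/
def cDiff (χ : H → k) {n : ℕ} (ψ : (Fin n → H) → k) : (Fin (n + 1) → H) → k := fun h =>
  χ (h 0) * ψ (fun j => h j.succ)
    + ∑ j : Fin n, ((-1 : ℤ) ^ ((j : ℕ) + 1)) • ψ (mergeAt h j)
    + ((-1 : ℤ) ^ (n + 1)) • ψ (fun j => h j.castSucc)

/-- Left multiplication by the basis element `ḡ` on `k_αG` (modelled as `G → k`). -/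
def Lmul (α : G → G → kˣ) (g : G) : (G → k) →ₗ[k] (G → k) where
  toFun a := fun y => (α g (g⁻¹ * y) : k) * a (g⁻¹ * y)
  map_add' a b := by funext y; simp [mul_add]
  map_smul' c a := by funext y; simp [smul_eq_mul]; ring

/-- Right multiplication by the basis element `ḡ` on `k_αG` (modelled as `G → k`). -/
def Rmul (α : G → G → kˣ) (g : G) : (G → k) →ₗ[k] (G → k) where
  toFun a := fun y => (α (y * g⁻¹) g : k) * a (y * g⁻¹)
  map_add' a b := by funext y; simp [mul_add]
  map_smul' c a := by funext y; simp [smul_eq_mul]; ring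

/-- Iterated right multiplication: `rmuls α [g₁,…,gₙ] v = v·ḡ₁·…·ḡₙ`. -/
def rmuls (α : G → G → kˣ) (l : List G) (v : G → k) : G → k :=
  l.foldl (fun w g => Rmul α g w) v

/-- Iterated right multiplication by inverses of basis elements:
`rinvs α [h₁,…,hₙ] v = v·h̄ₙ⁻¹·…·h̄₁⁻¹`, using `h̄⁻¹ = α(h,h⁻¹)⁻¹·(h⁻¹)‾`. -/
def rinvs (α : G → G → kˣ) (l : List G) (v : G → k) : G → k :=
  l.foldr (fun h w => (((α h h⁻¹)⁻¹ : kˣ) : k) • Rmul α h⁻¹ w) v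

/-- The character through which `h ∈ C_G(x)` acts on the module `k x̄`:
`χ(h) = α(h,x)·α(x,h)⁻¹`. -/
def chi (α : G → G → kˣ) (x : G) : G → k := fun h =>
  (α h x : k) * (((α x h)⁻¹ : kˣ) : k)

/-- The map `π^n_{G,x,α} : C^n(k_αG, k_αG) → C^n(C_G(x), k x̄)`: the value on
`(h₁,…,hₙ)` is the coefficient of the basis element `x̄` in
`φ(h̄₁⊗…⊗h̄ₙ)·h̄ₙ⁻¹·…·h̄₁⁻¹` (identifying `k x̄` with `k`). -/
def piC (α : G → G → kˣ) (x : G) {n : ℕ} (φ : (Fin n → G) → (G → k)) :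
    (Fin n → Subgroup.centralizer ({x} : Set G)) → k := fun h =>
  rinvs α (List.ofFn fun i => (h i : G)) (φ fun i => (h i : G)) x

/-- The same map as `piC` for a central element `x`, in which case `C_G(x) = G`:
`π^n_{G,x,α} : C^n(k_αG, k_αG) → C^n(G, k x̄)`. -/
def piZ (α : G → G → kˣ) (x : G) {n : ℕ} (φ : (Fin n → G) → (G → k)) :
    (Fin n → G) → k := fun h =>
  rinvs α (List.ofFn h) (φ h) x

/-- The map `ν^n_{G,x,α} : C^n(G, k x̄) → C^n(k_αG, k_αG)` for `x ∈ Z(G)`: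
`ψ ↦ (ḡ₁⊗…⊗ḡₙ ↦ ψ(g₁,…,gₙ)·x̄·ḡ₁·…·ḡₙ)` (identifying `k x̄` with `k`). -/
def nuZ (α : G → G → kˣ) (x : G) {n : ℕ} (ψ : (Fin n → G) → k) :
    (Fin n → G) → (G → k) := fun g =>
  ψ g • rmuls α (List.ofFn g) (Pi.single x 1)

/-- Iteration of the index map of a coset decomposition along a list of group
elements: `chainIdx idx j [g₁,…,gᵢ]` is the index `s_j^i`. -/
def chainIdx {m : ℕ} (idx : Fin m → G → Fin m) (j : Fin m) : List G → Fin m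
  | [] => j
  | a :: l => chainIdx idx (idx j a) l

/-- The map `ν^n_{G,x} : C^n(C_G(x), kx) → C^n(kG, kG)` for the (untwisted) group
algebra, relative to a right coset decomposition `G = ⋃ⱼ C_G(x)γⱼ`:
`ν(ψ)(g₁⊗…⊗gₙ) = Σⱼ ψ(h_{j,1},…,h_{j,n})·x⁻¹·xⱼ·g₁⋯gₙ` where
`xⱼ = γⱼ⁻¹xγⱼ`, the `h_{j,i} = rep (s_j^{i-1}) gᵢ ∈ C_G(x)` are determined by
`γ_{s_j^{i-1}}·gᵢ = h_{j,i}·γ_{s_j^i}` and `kx` is identified with `k`. -/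
def nuT (x : G) {m n : ℕ} (γ : Fin m → G) (idx : Fin m → G → Fin m)
    (rep : Fin m → G → G)
    (hrep : ∀ j a, rep j a ∈ Subgroup.centralizer ({x} : Set G))
    (ψ : (Fin n → Subgroup.centralizer ({x} : Set G)) → k) :
    (Fin n → G) → (G → k) := fun g =>
  ∑ j : Fin m,
    ψ (fun i => ⟨rep (chainIdx idx j ((List.ofFn g).take (i : ℕ))) (g i), hrep _ _⟩) •
      (Pi.single ((γ j)⁻¹ * x * γ j * (List.ofFn g).prod) (1 : k) : G → k)

/-- `φ` is a Hochschild coboundary (for `n = 0` the coboundary space is `0`). -/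
def IsHCoboundary (α : G → G → kˣ) (L R : G → M →ₗ[k] M) :
    ∀ {n : ℕ}, ((Fin n → G) → M) → Prop
  | 0, φ => φ = 0
  | _ + 1, φ => ∃ θ, φ = hDiff α L R θ

/-- `φ` is the Hochschild coboundary of a `Σ`-invariant cochain. -/
def IsHSCoboundary (α : G → G → kˣ) (L R : G → M →ₗ[k] M) :
    ∀ {n : ℕ}, ((Fin n → G) → M) → Prop
  | 0, φ => φ = 0
  | _ + 1, φ => ∃ θ, (∀ i0, hSigma α L R i0 θ = θ) ∧ φ = hDiff α L R θ

/-- `ψ` is a group-cohomology coboundary (coefficients in `k` through `χ`). -/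
def IsCCoboundary (χ : H → k) : ∀ {n : ℕ}, ((Fin n → H) → k) → Prop
  | 0, ψ => ψ = 0
  | _ + 1, ψ => ∃ θ, ψ = cDiff χ θ

/-- `ψ` is the coboundary of a `Σ`-invariant group cochain (coefficients through `χ`). -/
def IsCSCoboundary (χ : H → k) : ∀ {n : ℕ}, ((Fin n → H) → k) → Prop
  | 0, ψ => ψ = 0
  | _ + 1, ψ => ∃ θ, (∀ i0, cSigma χ i0 θ = θ) ∧ ψ = cDiff χ θ

/-- `ψ` is a group-cohomology coboundary (coefficients in the `H`-module `A`). -/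
def IsGCoboundary : ∀ {n : ℕ}, ((Fin n → H) → A) → Prop
  | 0, ψ => ψ = 0
  | _ + 1, ψ => ∃ θ, ψ = gDiff θ

/-- `ψ` is the coboundary of a `Σ`-invariant group cochain (coefficients in `A`). -/
def IsGSCoboundary : ∀ {n : ℕ}, ((Fin n → H) → A) → Prop
  | 0, ψ => ψ = 0
  | _ + 1, ψ => ∃ θ, (∀ i0, gSigma i0 θ = θ) ∧ ψ = gDiff θ

end Defs

section Paths

variable {H : Type*} [Group H] {n : ℕ}

/-- The tuple of successive quotients `eᵢ⁻¹eᵢ₊₁` of a path `e` in a group. -/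
def steps (e : Fin (n + 1) → H) : Fin n → H := fun i => (e i.castSucc)⁻¹ * e i.succ

theorem exists_steps_eq (a : H) (g : Fin n → H) :
    ∃ e : Fin (n + 1) → H, e 0 = a ∧ steps e = g := by
  refine ⟨fun i => a * Fin.partialProd g i, by simp, ?_⟩
  funext i
  rw [← Fin.partialProd_right_inv g i]
  simp [steps, mul_assoc]

theorem prod_ofFn_steps (e : Fin (n + 1) → H) :
    (List.ofFn (steps e)).prod = (e 0)⁻¹ * e (Fin.last n) := by
  induction n with
  | zero => simp
  | succ n ih =>
    have h := ih fun i => e i.succ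
    have hs : (fun i : Fin n => steps e i.succ) = steps fun i => e i.succ := rfl
    rw [List.ofFn_succ, List.prod_cons, hs, h]
    simp [steps, mul_assoc]

theorem swapTuple_steps (i : Fin n) (e : Fin (n + 1) → H) :
    swapTuple i (steps e) = steps fun l => e (Equiv.swap i.castSucc i.succ l) := by
  funext j
  rcases lt_trichotomy j i with hji | rfl | hji
  · have h1 : Equiv.swap i.castSucc i.succ j.castSucc = j.castSucc :=
      Equiv.swap_apply_of_ne_of_ne (by simp [Fin.ext_iff]; omega) (by simp [Fin.ext_iff]; omega)
    by_cases h : (j : ℕ) + 1 = i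
    · have h2 : j.succ = i.castSucc := by ext; simpa using h
      simp [swapTuple, steps, h, h1, h2, mul_assoc]
    · have h2 : Equiv.swap i.castSucc i.succ j.succ = j.succ :=
        Equiv.swap_apply_of_ne_of_ne (by simp [Fin.ext_iff]; omega) (by simp [Fin.ext_iff]; omega)
      have h3 : ¬ (j : ℕ) = i + 1 := by omega
      simp [swapTuple, steps, h, h1, h2, h3, hji.ne]
  · simp [swapTuple, steps]
  · have h1 : Equiv.swap i.castSucc i.succ j.succ = j.succ :=
      Equiv.swap_apply_of_ne_of_ne (by simp [Fin.ext_iff]; omega) (by simp [Fin.ext_iff]; omega)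
    have h0 : ¬ (j : ℕ) + 1 = i := by omega
    by_cases h : (j : ℕ) = i + 1
    · have h2 : j.castSucc = i.succ := by ext; simpa using h
      simp [swapTuple, steps, h, h1, h2, mul_assoc, hji.ne']
      omega
    · have h2 : Equiv.swap i.castSucc i.succ j.castSucc = j.castSucc :=
        Equiv.swap_apply_of_ne_of_ne (by simp [Fin.ext_iff]; omega) (by simp [Fin.ext_iff]; omega)
      simp [swapTuple, steps, h, h1, h2, h0, hji.ne']

theorem mergeAt_steps (j : Fin n) (e : Fin (n + 2) → H) :
    mergeAt (steps e) j = steps fun l => e (j.succ.castSucc.succAbove l) := by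
  funext l
  rcases lt_trichotomy l j with hlj | rfl | hlj
  · have h1 : j.succ.castSucc.succAbove l.castSucc = l.castSucc.castSucc :=
      Fin.succAbove_of_castSucc_lt _ _ (by rw [Fin.lt_def] at *; simp; omega)
    have h2 : j.succ.castSucc.succAbove l.succ = l.succ.castSucc :=
      Fin.succAbove_of_castSucc_lt _ _ (by rw [Fin.lt_def] at *; simp; omega)
    have h3 : (l : ℕ) < j := hlj
    simp only [mergeAt, steps, h1, h2, h3, if_true, Fin.succ_castSucc]
  · have h1 : l.succ.castSucc.succAbove l.castSucc = l.castSucc.castSucc :=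
      Fin.succAbove_of_castSucc_lt _ _ (by simp [Fin.lt_def])
    have h2 : l.succ.castSucc.succAbove l.succ = l.succ.succ :=
      Fin.succAbove_of_le_castSucc _ _ (by simp)
    simp only [mergeAt, steps, h1, h2, lt_irrefl, if_true, if_false]
    simp [mul_assoc]
  · have h1 : j.succ.castSucc.succAbove l.castSucc = l.castSucc.succ :=
      Fin.succAbove_of_le_castSucc _ _ (by rw [Fin.le_def]; simp; omega)
    have h2 : j.succ.castSucc.succAbove l.succ = l.succ.succ :=
      Fin.succAbove_of_le_castSucc _ _ (by rw [Fin.le_def]; simp; omega)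
    have h3 : ¬ (l : ℕ) < j := by omega
    simp only [mergeAt, steps, h1, h2, h3, hlj.ne', if_false, Fin.succ_castSucc]

theorem prod_ofFn_swapTuple (i : Fin n) (g : Fin n → H) :
    (List.ofFn (swapTuple i g)).prod =
      (if (i : ℕ) = 0 then (g i)⁻¹ else 1) * (List.ofFn g).prod *
        (if (i : ℕ) + 1 = n then (g i)⁻¹ else 1) := by
  obtain ⟨e, -, rfl⟩ := exists_steps_eq 1 g
  rw [swapTuple_steps, prod_ofFn_steps, prod_ofFn_steps]
  have h0 : (e (Equiv.swap i.castSucc i.succ 0))⁻¹ =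
      (if (i : ℕ) = 0 then (steps e i)⁻¹ else 1) * (e 0)⁻¹ := by
    split_ifs with h
    · have h2 : (0 : Fin (n + 1)) = i.castSucc := by ext; simpa using h.symm
      simp [h2, steps]
    · rw [Equiv.swap_apply_of_ne_of_ne (by simp [Fin.ext_iff]; omega)
        (by simp [Fin.ext_iff]), one_mul]
  have h1 : e (Equiv.swap i.castSucc i.succ (Fin.last n)) =
      e (Fin.last n) * (if (i : ℕ) + 1 = n then (steps e i)⁻¹ else 1) := by
    split_ifs with h
    · have h2 : Fin.last n = i.succ := by ext; simpa using h.symm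
      simp [h2, steps]
    · rw [Equiv.swap_apply_of_ne_of_ne (by simp [Fin.ext_iff]; omega)
        (by simp [Fin.ext_iff]; omega), mul_one]
  rw [h0, h1]
  simp only [mul_assoc]

theorem prod_ofFn_mergeAt (j : Fin n) (g : Fin (n + 1) → H) :
    (List.ofFn (mergeAt g j)).prod = (List.ofFn g).prod := by
  obtain ⟨e, -, rfl⟩ := exists_steps_eq 1 g
  have h0 : j.succ.castSucc.succAbove 0 = 0 :=
    Fin.succAbove_of_castSucc_lt _ _ (by simp [Fin.lt_def])
  have h1 : j.succ.castSucc.succAbove (Fin.last n) = Fin.last (n + 1) :=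
    Fin.succAbove_of_le_castSucc _ _ (by rw [Fin.le_def]; simp)
  rw [mergeAt_steps, prod_ofFn_steps, prod_ofFn_steps, h0, h1]

theorem map_swapTuple {K : Type*} [Group K] (f : H →* K) (i : Fin n) (g : Fin n → H) :
    swapTuple i (fun l => f (g l)) = fun l => f (swapTuple i g l) := by
  funext j
  simp only [swapTuple]
  split_ifs <;> simp

theorem map_mergeAt {K : Type*} [Group K] (f : H →* K) (j : Fin n) (g : Fin (n + 1) → H) :
    mergeAt (fun l => f (g l)) j = fun l => f (mergeAt g j l) := by
  funext l
  simp only [mergeAt]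
  split_ifs <;> simp

end Paths

section Cochains

variable {k : Type*} {G : Type*} [Group G] {n : ℕ}

/-- The coefficient of `u` in `φ(g₁⊗…⊗gₙ)·gₙ⁻¹⋯g₁⁻¹`. -/
def coeffAt (φ : (Fin n → G) → (G → k)) (g : Fin n → G) (u : G) : k :=
  φ g (u * (List.ofFn g).prod)

theorem ext_coeffAt {φ φ' : (Fin n → G) → (G → k)}
    (h : ∀ g u, coeffAt φ g u = coeffAt φ' g u) : φ = φ' := by
  funext g y
  simpa [coeffAt] using h g (y * (List.ofFn g).prod⁻¹)

variable [CommRing k]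

theorem coeffAt_hSigma (i : Fin n) (φ : (Fin n → G) → (G → k)) (g : Fin n → G) (u : G) :
    coeffAt (hSigma (fun _ _ => (1 : kˣ)) (Lmul fun _ _ => (1 : kˣ))
        (Rmul fun _ _ => (1 : kˣ)) i φ) g u =
      -(if (i : ℕ) = 0 then coeffAt φ (swapTuple i g) ((g i)⁻¹ * u * g i)
        else coeffAt φ (swapTuple i g) u) := by
  simp only [coeffAt, prod_ofFn_swapTuple, hSigma]
  split_ifs <;> simp [Lmul, Rmul, mul_assoc]

theorem coeffAt_hDiff (φ : (Fin n → G) → (G → k)) (g : Fin (n + 1) → G) (u : G) :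
    coeffAt (hDiff (fun _ _ => (1 : kˣ)) (Lmul fun _ _ => (1 : kˣ))
        (Rmul fun _ _ => (1 : kˣ)) φ) g u =
      coeffAt φ (fun j => g j.succ) ((g 0)⁻¹ * u * g 0)
        + ∑ j : Fin n, ((-1 : ℤ) ^ ((j : ℕ) + 1)) • coeffAt φ (mergeAt g j) u
        + ((-1 : ℤ) ^ (n + 1)) • coeffAt φ (fun j => g j.castSucc) u := by
  have hl : (List.ofFn g).prod = (List.ofFn fun j : Fin n => g j.castSucc).prod *
      g (Fin.last n) := by
    rw [List.ofFn_succ', List.concat_eq_append, List.prod_append, List.prod_singleton]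
  have hr : (g 0)⁻¹ * (u * (List.ofFn g).prod) =
      (g 0)⁻¹ * u * g 0 * (List.ofFn fun j : Fin n => g j.succ).prod := by
    rw [List.ofFn_succ, List.prod_cons]
    simp only [mul_assoc]
  simp only [coeffAt, prod_ofFn_mergeAt]
  simp only [hDiff, Lmul, Rmul, LinearMap.coe_mk, AddHom.coe_mk, Pi.add_apply, Finset.sum_apply,
    Pi.smul_apply, Units.val_one, one_mul, one_smul, hr]
  rw [hl, mul_assoc u, mul_inv_cancel_right]

theorem rinvs_one (l : List G) (v : G → k) (y : G) :
    rinvs (fun _ _ => (1 : kˣ)) l v y = v (y * l.prod) := by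
  induction l generalizing y with
  | nil => simp [rinvs]
  | cons a l ih =>
    have h : rinvs (fun _ _ => (1 : kˣ)) (a :: l) v y =
        rinvs (fun _ _ => (1 : kˣ)) l v (y * a) := by
      simp [rinvs, Rmul]
    rw [h, ih, List.prod_cons, mul_assoc]

theorem piC_one (x : G) (φ : (Fin n → G) → (G → k))
    (h : Fin n → Subgroup.centralizer ({x} : Set G)) :
    piC (fun _ _ => (1 : kˣ)) x φ h = coeffAt φ (fun i => (h i : G)) x := by
  rw [piC, rinvs_one, coeffAt]

theorem inv_mul_mul_of_mem_centralizer {x : G}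
    (h : Subgroup.centralizer ({x} : Set G)) : (h : G)⁻¹ * x * h = x := by
  have := Subgroup.mem_centralizer_singleton_iff.1 h.2
  rw [mul_assoc, ← this, inv_mul_cancel_left]

theorem piC_sub (x : G) (φ φ' : (Fin n → G) → (G → k)) :
    piC (fun _ _ => (1 : kˣ)) x φ - piC (fun _ _ => (1 : kˣ)) x φ' =
      piC (fun _ _ => (1 : kˣ)) x (φ - φ') := by
  funext h
  simp [piC_one, coeffAt]

theorem cSigma_piC (x : G) (i : Fin n) (φ : (Fin n → G) → (G → k)) :
    cSigma (fun _ => (1 : k)) i (piC (fun _ _ => (1 : kˣ)) x φ) =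
      piC (fun _ _ => (1 : kˣ)) x (hSigma (fun _ _ => (1 : kˣ)) (Lmul fun _ _ => (1 : kˣ))
        (Rmul fun _ _ => (1 : kˣ)) i φ) := by
  funext h
  have hs := map_swapTuple (Subgroup.centralizer ({x} : Set G)).subtype i h
  simp only [Subgroup.coe_subtype] at hs
  simp only [cSigma, piC_one, coeffAt_hSigma, inv_mul_mul_of_mem_centralizer, hs, one_mul]

theorem cDiff_piC (x : G) (φ : (Fin n → G) → (G → k)) :
    cDiff (fun _ => (1 : k)) (piC (fun _ _ => (1 : kˣ)) x φ) =
      piC (fun _ _ => (1 : kˣ)) x (hDiff (fun _ _ => (1 : kˣ)) (Lmul fun _ _ => (1 : kˣ))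
        (Rmul fun _ _ => (1 : kˣ)) φ) := by
  funext h
  have hs := fun j => map_mergeAt (Subgroup.centralizer ({x} : Set G)).subtype j h
  simp only [Subgroup.coe_subtype] at hs
  simp only [cDiff, piC_one, coeffAt_hDiff, inv_mul_mul_of_mem_centralizer, hs, one_mul]

theorem piC_zero (x : G) :
    piC (fun _ _ => (1 : kˣ)) x (0 : (Fin n → G) → (G → k)) = 0 := by
  funext h
  simp [piC_one, coeffAt]

theorem IsHSCoboundary.piC {φ : (Fin n → G) → (G → k)}
    (hφ : IsHSCoboundary (fun _ _ => (1 : kˣ)) (Lmul fun _ _ => (1 : kˣ))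
      (Rmul fun _ _ => (1 : kˣ)) φ) (x : G) :
    IsCSCoboundary (fun _ => (1 : k)) (piC (fun _ _ => (1 : kˣ)) x φ) := by
  cases n with
  | zero =>
    simp only [IsHSCoboundary] at hφ
    simp only [IsCSCoboundary, hφ, piC_zero]
  | succ n =>
    obtain ⟨θ, hθ, rfl⟩ := hφ
    exact ⟨TwistedSym.piC (fun _ _ => (1 : kˣ)) x θ, fun i => by rw [cSigma_piC, hθ i],
      (cDiff_piC x θ).symm⟩

theorem isCSCoboundary_zero {H : Type*} [Group H] (χ : H → k) :
    IsCSCoboundary χ (0 : (Fin n → H) → k) := by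
  cases n with
  | zero => rfl
  | succ n =>
    refine ⟨0, fun i => ?_, ?_⟩
    · funext h; simp [cSigma]
    · funext h; simp [cDiff]

end Cochains

theorem chainIdx_concat {G : Type*} {m : ℕ} (idx : Fin m → G → Fin m) (j : Fin m) (l : List G) (a : G) :
    chainIdx idx j (l ++ [a]) = idx (chainIdx idx j l) a := by
  induction l generalizing j with
  | nil => rfl
  | cons b l ih => exact ih _

section Nu

variable {k : Type*} [CommRing k] {G : Type*} [Group G] {x : G} {m n : ℕ}

theorem conj_isConj_iff {u : G} (a : G) : IsConj x (a⁻¹ * u * a) ↔ IsConj x u := by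
  have : IsConj u (a⁻¹ * u * a) := isConj_iff.2 ⟨a⁻¹, by simp⟩
  exact ⟨fun h => h.trans this.symm, fun h => h.trans this⟩

theorem exists_steps_of_isConj (g : Fin n → G) {u : G} (hu : IsConj x u) :
    ∃ e : Fin (n + 1) → G, (e 0)⁻¹ * x * e 0 = u ∧ steps e = g := by
  obtain ⟨c, rfl⟩ := isConj_iff.1 hu
  obtain ⟨e, he, rfl⟩ := exists_steps_eq c⁻¹ g
  exact ⟨e, by simp [he], rfl⟩

/-- `e = h·γⱼ` with `h ∈ C_G(x)` gives a left `C_G(x)`-equivariant retraction `e ↦ h`. -/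
noncomputable def centralizerPart (γ : Fin m → G)
    (hcover : ∀ g : G, ∃! j : Fin m, g * (γ j)⁻¹ ∈ Subgroup.centralizer ({x} : Set G)) (e : G) :
    Subgroup.centralizer ({x} : Set G) :=
  ⟨e * (γ (hcover e).choose)⁻¹, (hcover e).choose_spec.1⟩

variable {γ : Fin m → G} {idx : Fin m → G → Fin m} {rep : Fin m → G → G}
  {hrep : ∀ j a, rep j a ∈ Subgroup.centralizer ({x} : Set G)}
  (hidx : ∀ j a, γ j * a = rep j a * γ (idx j a))
  (hcover : ∀ g : G, ∃! j : Fin m, g * (γ j)⁻¹ ∈ Subgroup.centralizer ({x} : Set G))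

theorem coe_centralizerPart {e : G} {j : Fin m}
    (hj : e * (γ j)⁻¹ ∈ Subgroup.centralizer ({x} : Set G)) :
    (centralizerPart γ hcover e : G) = e * (γ j)⁻¹ := by
  rw [(hcover e).unique hj (hcover e).choose_spec.1]
  rfl

theorem centralizerPart_coe (hm : 0 < m) (hγ : γ ⟨0, hm⟩ = 1)
    (h : Subgroup.centralizer ({x} : Set G)) : centralizerPart γ hcover (h : G) = h := by
  ext
  rw [coe_centralizerPart hcover (j := ⟨0, hm⟩) (by simp [hγ]), hγ, inv_one, mul_one]

include hrep hidx in
theorem mul_inv_chainIdx_mem (e : Fin (n + 1) → G) {j : Fin m}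
    (hj : e 0 * (γ j)⁻¹ ∈ Subgroup.centralizer ({x} : Set G)) (i : ℕ) (hi : i < n + 1) :
    e ⟨i, hi⟩ * (γ (chainIdx idx j ((List.ofFn (steps e)).take i)))⁻¹ ∈
      Subgroup.centralizer ({x} : Set G) := by
  induction i with
  | zero => exact hj
  | succ i ih =>
    have hin : i < n := by omega
    specialize ih (by omega)
    rw [List.take_succ_eq_append_getElem (by simpa using hin), chainIdx_concat,
      List.getElem_ofFn]
    set s := chainIdx idx j ((List.ofFn (steps e)).take i)
    set a := steps e ⟨i, hin⟩ with ha
    have he : e ⟨i + 1, hi⟩ = e ⟨i, by omega⟩ * a := by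
      simp [ha, steps]
    have h2 : e ⟨i + 1, hi⟩ * (γ (idx s a))⁻¹ =
        e ⟨i, by omega⟩ * (γ s)⁻¹ * rep s a := by
      have h3 : rep s a = γ s * a * (γ (idx s a))⁻¹ := by rw [hidx s a]; simp
      rw [he, h3]
      group
    rw [h2]
    exact mul_mem ih (hrep s a)

include hidx in
theorem rep_chainIdx (e : Fin (n + 1) → G) {j : Fin m}
    (hj : e 0 * (γ j)⁻¹ ∈ Subgroup.centralizer ({x} : Set G)) :
    (fun i : Fin n => (⟨rep (chainIdx idx j ((List.ofFn (steps e)).take (i : ℕ))) (steps e i),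
      hrep _ _⟩ : Subgroup.centralizer ({x} : Set G))) =
      steps fun l => centralizerPart γ hcover (e l) := by
  funext i
  ext
  have h0 := mul_inv_chainIdx_mem (hrep := hrep) hidx e hj i (by omega)
  have h1 := mul_inv_chainIdx_mem (hrep := hrep) hidx e hj (i + 1) (by omega)
  have c0 := coe_centralizerPart hcover h0
  have c1 := coe_centralizerPart hcover h1
  rw [List.take_succ_eq_append_getElem (by simp), chainIdx_concat,
    List.getElem_ofFn] at c1
  have h3 := hidx (chainIdx idx j ((List.ofFn (steps e)).take (i : ℕ))) (steps e i)
  have h4 := eq_mul_inv_of_mul_eq h3.symm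
  change (centralizerPart γ hcover (e i.castSucc) : G) = e i.castSucc * _ at c0
  change (centralizerPart γ hcover (e i.succ) : G) =
    e i.succ * (γ (idx (chainIdx idx j ((List.ofFn (steps e)).take (i : ℕ))) (steps e i)))⁻¹ at c1
  simp only [steps, Subgroup.coe_mul, Subgroup.coe_inv, c0, c1] at h4 ⊢
  rw [h4]
  group

variable [DecidableEq G]

theorem coeffAt_nuT (ψ : (Fin n → Subgroup.centralizer ({x} : Set G)) → k) (g : Fin n → G)
    (u : G) :
    coeffAt (nuT x γ idx rep hrep ψ) g u = ∑ j : Fin m,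
      if (γ j)⁻¹ * x * γ j = u then
        ψ (fun i => ⟨rep (chainIdx idx j ((List.ofFn g).take (i : ℕ))) (g i), hrep _ _⟩)
      else 0 := by
  simp [coeffAt, nuT, Finset.sum_apply, Pi.single_apply, eq_comm]

theorem coeffAt_nuT_of_not_isConj (ψ : (Fin n → Subgroup.centralizer ({x} : Set G)) → k)
    (g : Fin n → G) {u : G} (hu : ¬ IsConj x u) :
    coeffAt (nuT x γ idx rep hrep ψ) g u = 0 := by
  rw [coeffAt_nuT]
  refine Finset.sum_eq_zero fun j _ => if_neg fun h => hu ?_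
  exact isConj_iff.2 ⟨(γ j)⁻¹, by simpa using h⟩

include hidx in
theorem coeffAt_nuT_steps (ψ : (Fin n → Subgroup.centralizer ({x} : Set G)) → k)
    (e : Fin (n + 1) → G) :
    coeffAt (nuT x γ idx rep hrep ψ) (steps e) ((e 0)⁻¹ * x * e 0) =
      ψ (steps fun l => centralizerPart γ hcover (e l)) := by
  have hiff : ∀ j, (γ j)⁻¹ * x * γ j = (e 0)⁻¹ * x * e 0 ↔
      e 0 * (γ j)⁻¹ ∈ Subgroup.centralizer ({x} : Set G) := by
    intro j
    rw [Subgroup.mem_centralizer_singleton_iff]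
    constructor
    · intro h
      have : e 0 * ((γ j)⁻¹ * x * γ j) * (γ j)⁻¹ =
        e 0 * ((e 0)⁻¹ * x * e 0) * (γ j)⁻¹ := by rw [h]
      simpa [mul_assoc] using this
    · intro h
      have : (e 0)⁻¹ * (e 0 * (γ j)⁻¹ * x) * γ j =
        (e 0)⁻¹ * (x * (e 0 * (γ j)⁻¹)) * γ j := by rw [h]
      simpa [mul_assoc] using this
  obtain ⟨j, hj, huniq⟩ := hcover (e 0)
  rw [coeffAt_nuT, Finset.sum_eq_single j, if_pos ((hiff j).2 hj), rep_chainIdx hidx hcover e hj]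
  · exact fun i _ hij => if_neg fun h => hij (huniq i ((hiff i).1 h))
  · simp

include hidx hcover in
theorem hSigma_nuT (ψ : (Fin n → Subgroup.centralizer ({x} : Set G)) → k) (i : Fin n) :
    hSigma (fun _ _ => (1 : kˣ)) (Lmul fun _ _ => (1 : kˣ)) (Rmul fun _ _ => (1 : kˣ)) i
      (nuT x γ idx rep hrep ψ) =
      nuT x γ idx rep hrep (cSigma (fun _ => (1 : k)) i ψ) := by
  refine ext_coeffAt fun g u => ?_
  rw [coeffAt_hSigma]
  by_cases hu : IsConj x u
  · obtain ⟨e, rfl, rfl⟩ := exists_steps_of_isConj g hu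
    rw [coeffAt_nuT_steps hidx hcover]
    have key := coeffAt_nuT_steps (hrep := hrep) hidx hcover ψ
      fun l => e (Equiv.swap i.castSucc i.succ l)
    simp only [cSigma, one_mul, ite_self, swapTuple_steps]
    rw [← key]
    split_ifs with h
    · have h2 : (0 : Fin (n + 1)) = i.castSucc := by ext; simpa using h.symm
      simp only [h2, Equiv.swap_apply_left]
      simp [steps, mul_assoc]
    · rw [Equiv.swap_apply_of_ne_of_ne (by simp [Fin.ext_iff]; omega) (by simp [Fin.ext_iff])]
  · rw [coeffAt_nuT_of_not_isConj _ _ hu, coeffAt_nuT_of_not_isConj _ _ hu,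
      coeffAt_nuT_of_not_isConj _ _ (by rwa [conj_isConj_iff])]
    simp

include hidx hcover in
theorem hDiff_nuT (ψ : (Fin n → Subgroup.centralizer ({x} : Set G)) → k) :
    hDiff (fun _ _ => (1 : kˣ)) (Lmul fun _ _ => (1 : kˣ)) (Rmul fun _ _ => (1 : kˣ))
      (nuT x γ idx rep hrep ψ) =
      nuT x γ idx rep hrep (cDiff (fun _ => (1 : k)) ψ) := by
  refine ext_coeffAt fun g u => ?_
  rw [coeffAt_hDiff]
  by_cases hu : IsConj x u
  · obtain ⟨e, rfl, rfl⟩ := exists_steps_of_isConj g hu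
    rw [coeffAt_nuT_steps hidx hcover]
    have key := fun e => coeffAt_nuT_steps (n := n) (hrep := hrep) hidx hcover ψ e
    have hfirst := key fun l => e l.succ
    have hlast := key fun l => e l.castSucc
    have hmid := fun j : Fin n => key fun l => e (j.succ.castSucc.succAbove l)
    have h0 : ∀ j : Fin n, j.succ.castSucc.succAbove 0 = 0 := fun j =>
      Fin.succAbove_of_castSucc_lt _ _ (by simp [Fin.lt_def])
    have hu0 : (steps e 0)⁻¹ * ((e 0)⁻¹ * x * e 0) * steps e 0 =
        (e (Fin.succ 0))⁻¹ * x * e (Fin.succ 0) := by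
      simp [steps, mul_assoc]
    simp only [h0] at hmid
    simp only [cDiff, one_mul, mergeAt_steps, hmid, hu0]
    congr 1
    · congr 1
    · congr 1
  · rw [coeffAt_nuT_of_not_isConj _ _ hu, coeffAt_nuT_of_not_isConj _ _ hu,
      coeffAt_nuT_of_not_isConj _ _ (by rwa [conj_isConj_iff])]
    simp [coeffAt_nuT_of_not_isConj _ _ hu]

theorem nuT_sub (ψ ψ' : (Fin n → Subgroup.centralizer ({x} : Set G)) → k) :
    nuT x γ idx rep hrep ψ - nuT x γ idx rep hrep ψ' = nuT x γ idx rep hrep (ψ - ψ') := by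
  funext g
  simp [nuT, sub_smul]

theorem nuT_zero :
    nuT x γ idx rep hrep (0 : (Fin n → Subgroup.centralizer ({x} : Set G)) → k) = 0 := by
  funext g
  simp [nuT]

include hidx hcover in
theorem IsCSCoboundary.nuT {ψ : (Fin n → Subgroup.centralizer ({x} : Set G)) → k}
    (hψ : IsCSCoboundary (fun _ => (1 : k)) ψ) :
    IsHSCoboundary (fun _ _ => (1 : kˣ)) (Lmul fun _ _ => (1 : kˣ)) (Rmul fun _ _ => (1 : kˣ))
      (nuT x γ idx rep hrep ψ) := by
  cases n with
  | zero =>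
    simp only [IsCSCoboundary] at hψ
    simp only [IsHSCoboundary, hψ, nuT_zero]
  | succ n =>
    obtain ⟨θ, hθ, rfl⟩ := hψ
    exact ⟨TwistedSym.nuT x γ idx rep hrep θ, fun i => by rw [hSigma_nuT hidx hcover, hθ i],
      (hDiff_nuT hidx hcover θ).symm⟩

include hidx hcover in
theorem piC_nuT_self (hm : 0 < m) (hγ : γ ⟨0, hm⟩ = 1)
    (ψ : (Fin n → Subgroup.centralizer ({x} : Set G)) → k) :
    piC (fun _ _ => (1 : kˣ)) x (nuT x γ idx rep hrep ψ) = ψ := by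
  funext h
  obtain ⟨e, he, rfl⟩ := exists_steps_eq 1 h
  have key := coeffAt_nuT_steps (hrep := hrep) hidx hcover ψ fun l => (e l : G)
  simp only [centralizerPart_coe hcover hm hγ, he, OneMemClass.coe_one, inv_one, one_mul,
    mul_one] at key
  rw [piC_one, ← key]
  rfl

theorem piC_nuT_of_not_isConj {y : G} (hxy : ¬ IsConj x y)
    (ψ : (Fin n → Subgroup.centralizer ({x} : Set G)) → k) :
    piC (fun _ _ => (1 : kˣ)) y (nuT x γ idx rep hrep ψ) = 0 := by
  funext h
  rw [piC_one, coeffAt_nuT_of_not_isConj _ _ hxy]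
  rfl

end Nu

section Sums

variable {k : Type*} [CommRing k] {G ι : Type*} [Group G] {n : ℕ} (s : Finset ι)
  (φ : ι → (Fin n → G) → (G → k))

theorem coeffAt_sum (g : Fin n → G) (u : G) :
    coeffAt (∑ y ∈ s, φ y) g u = ∑ y ∈ s, coeffAt (φ y) g u := by
  simp [coeffAt, Finset.sum_apply]

theorem piC_sum (x : G) :
    piC (fun _ _ => (1 : kˣ)) x (∑ y ∈ s, φ y) = ∑ y ∈ s, piC (fun _ _ => (1 : kˣ)) x (φ y) := by
  funext h
  simp only [Finset.sum_apply, piC_one, coeffAt_sum]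

theorem hSigma_sum (i : Fin n) :
    hSigma (fun _ _ => (1 : kˣ)) (Lmul fun _ _ => (1 : kˣ)) (Rmul fun _ _ => (1 : kˣ)) i
      (∑ y ∈ s, φ y) =
      ∑ y ∈ s, hSigma (fun _ _ => (1 : kˣ)) (Lmul fun _ _ => (1 : kˣ))
        (Rmul fun _ _ => (1 : kˣ)) i (φ y) := by
  refine ext_coeffAt fun g u => ?_
  simp only [coeffAt_sum, coeffAt_hSigma, Finset.sum_neg_distrib]
  split_ifs <;> rfl

theorem hDiff_sum :
    hDiff (fun _ _ => (1 : kˣ)) (Lmul fun _ _ => (1 : kˣ)) (Rmul fun _ _ => (1 : kˣ))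
      (∑ y ∈ s, φ y) =
      ∑ y ∈ s, hDiff (fun _ _ => (1 : kˣ)) (Lmul fun _ _ => (1 : kˣ))
        (Rmul fun _ _ => (1 : kˣ)) (φ y) := by
  refine ext_coeffAt fun g u => ?_
  simp only [coeffAt_sum, coeffAt_hDiff, Finset.sum_add_distrib, Finset.smul_sum]
  rw [Finset.sum_comm]

end Sums

/-- for the group algebra `kG` and a set `X` of representatives of the
conjugacy classes of `G`, `ν^n_{G,x}` maps `CS^n(C_G(x),kx)` into `CS^n(kG,kG)` and
`π^n_{G,x}` maps `CS^n(kG,kG)` into `CS^n(C_G(x),kx)`, inducing maps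
`ν^{n,S}_{G,x} : HS^n(C_G(x),k) → HHS^n(kG)` and
`π^{n,S}_{G,x} : HHS^n(kG) → HS^n(C_G(x),k)` (identifying `kx` with the trivial
module `k`).  Moreover `⊕_{x∈X} ν^{n,S}_{G,x}` is injective with left inverse
`⊕_{x∈X} π^{n,S}_{G,x}` (hence the latter is surjective). -/
theorem symmetric_embedding_untwisted
    {k : Type*} [Field k] {G : Type*} [Group G] [Fintype G] [DecidableEq G]
    (X : Finset G) (hX : ∀ g : G, ∃! x, x ∈ X ∧ IsConj x g) {n : ℕ}
    (m : G → ℕ) (γ : ∀ x : G, Fin (m x) → G)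
    (idx : ∀ x : G, Fin (m x) → G → Fin (m x)) (rep : ∀ x : G, Fin (m x) → G → G)
    (hrep : ∀ x j a, rep x j a ∈ Subgroup.centralizer ({x} : Set G))
    (hm : ∀ x, 0 < m x) (hγ1 : ∀ x, γ x ⟨0, hm x⟩ = 1)
    (hidx : ∀ x j a, γ x j * a = rep x j a * γ x (idx x j a))
    (hcover : ∀ x g : G, ∃! j : Fin (m x),
      g * (γ x j)⁻¹ ∈ Subgroup.centralizer ({x} : Set G)) :
    -- ν preserves symmetric cochains
    (∀ x : G, ∀ ψ : (Fin n → Subgroup.centralizer ({x} : Set G)) → k,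
      (∀ i0 : Fin n, cSigma (fun _ => (1 : k)) i0 ψ = ψ) →
      ∀ i0 : Fin n,
        hSigma (fun _ _ => (1 : kˣ)) (Lmul fun _ _ => (1 : kˣ)) (Rmul fun _ _ => (1 : kˣ)) i0
          (nuT x (γ x) (idx x) (rep x) (hrep x) ψ) =
        nuT x (γ x) (idx x) (rep x) (hrep x) ψ) ∧
    -- π preserves symmetric cochains
    (∀ x : G, ∀ φ : (Fin n → G) → (G → k),
      (∀ i0 : Fin n,
        hSigma (fun _ _ => (1 : kˣ)) (Lmul fun _ _ => (1 : kˣ)) (Rmul fun _ _ => (1 : kˣ)) i0 φ = φ) →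
      ∀ i0 : Fin n, cSigma (fun _ => (1 : k)) i0 (piC (fun _ _ => (1 : kˣ)) x φ) =
        piC (fun _ _ => (1 : kˣ)) x φ) ∧
    -- ν induces a well-defined map on symmetric cohomology
    (∀ x : G,
      (∀ ψ : (Fin n → Subgroup.centralizer ({x} : Set G)) → k,
        (∀ i0 : Fin n, cSigma (fun _ => (1 : k)) i0 ψ = ψ) →
        cDiff (fun _ => (1 : k)) ψ = 0 →
        hDiff (fun _ _ => (1 : kˣ)) (Lmul fun _ _ => (1 : kˣ)) (Rmul fun _ _ => (1 : kˣ))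
          (nuT x (γ x) (idx x) (rep x) (hrep x) ψ) = 0) ∧
      (∀ ψ ψ' : (Fin n → Subgroup.centralizer ({x} : Set G)) → k,
        (∀ i0 : Fin n, cSigma (fun _ => (1 : k)) i0 ψ = ψ) →
        cDiff (fun _ => (1 : k)) ψ = 0 →
        (∀ i0 : Fin n, cSigma (fun _ => (1 : k)) i0 ψ' = ψ') →
        cDiff (fun _ => (1 : k)) ψ' = 0 →
        IsCSCoboundary (fun _ => (1 : k)) (ψ - ψ') →
        IsHSCoboundary (fun _ _ => (1 : kˣ)) (Lmul fun _ _ => (1 : kˣ)) (Rmul fun _ _ => (1 : kˣ))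
          (nuT x (γ x) (idx x) (rep x) (hrep x) ψ - nuT x (γ x) (idx x) (rep x) (hrep x) ψ'))) ∧
    -- π induces a well-defined map on symmetric cohomology
    (∀ x : G,
      (∀ φ : (Fin n → G) → (G → k),
        (∀ i0 : Fin n,
          hSigma (fun _ _ => (1 : kˣ)) (Lmul fun _ _ => (1 : kˣ)) (Rmul fun _ _ => (1 : kˣ)) i0 φ = φ) →
        hDiff (fun _ _ => (1 : kˣ)) (Lmul fun _ _ => (1 : kˣ)) (Rmul fun _ _ => (1 : kˣ)) φ = 0 →
        cDiff (fun _ => (1 : k)) (piC (fun _ _ => (1 : kˣ)) x φ) = 0) ∧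
      (∀ φ φ' : (Fin n → G) → (G → k),
        (∀ i0 : Fin n,
          hSigma (fun _ _ => (1 : kˣ)) (Lmul fun _ _ => (1 : kˣ)) (Rmul fun _ _ => (1 : kˣ)) i0 φ = φ) →
        hDiff (fun _ _ => (1 : kˣ)) (Lmul fun _ _ => (1 : kˣ)) (Rmul fun _ _ => (1 : kˣ)) φ = 0 →
        (∀ i0 : Fin n,
          hSigma (fun _ _ => (1 : kˣ)) (Lmul fun _ _ => (1 : kˣ)) (Rmul fun _ _ => (1 : kˣ)) i0 φ' = φ') →
        hDiff (fun _ _ => (1 : kˣ)) (Lmul fun _ _ => (1 : kˣ)) (Rmul fun _ _ => (1 : kˣ)) φ' = 0 →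
        IsHSCoboundary (fun _ _ => (1 : kˣ)) (Lmul fun _ _ => (1 : kˣ)) (Rmul fun _ _ => (1 : kˣ)) (φ - φ') →
        IsCSCoboundary (fun _ => (1 : k))
          (piC (fun _ _ => (1 : kˣ)) x φ - piC (fun _ _ => (1 : kˣ)) x φ'))) ∧
    -- ⊕ ν^{n,S} is injective on symmetric cohomology
    (∀ ψf : ∀ x : G, (Fin n → Subgroup.centralizer ({x} : Set G)) → k,
      (∀ x ∈ X, (∀ i0 : Fin n, cSigma (fun _ => (1 : k)) i0 (ψf x) = ψf x) ∧
        cDiff (fun _ => (1 : k)) (ψf x) = 0) →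
      IsHSCoboundary (fun _ _ => (1 : kˣ)) (Lmul fun _ _ => (1 : kˣ)) (Rmul fun _ _ => (1 : kˣ))
        (∑ y ∈ X, nuT y (γ y) (idx y) (rep y) (hrep y) (ψf y)) →
      ∀ x ∈ X, IsCSCoboundary (fun _ => (1 : k)) (ψf x)) ∧
    -- ⊕ π^{n,S} is a left inverse of ⊕ ν^{n,S} on symmetric cohomology
    (∀ ψf : ∀ x : G, (Fin n → Subgroup.centralizer ({x} : Set G)) → k,
      (∀ x ∈ X, (∀ i0 : Fin n, cSigma (fun _ => (1 : k)) i0 (ψf x) = ψf x) ∧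
        cDiff (fun _ => (1 : k)) (ψf x) = 0) →
      ∀ x ∈ X, IsCSCoboundary (fun _ => (1 : k))
        (piC (fun _ _ => (1 : kˣ)) x
          (∑ y ∈ X, nuT y (γ y) (idx y) (rep y) (hrep y) (ψf y)) - ψf x)) ∧
    -- ⊕ π^{n,S} is surjective on symmetric cohomology
    (∀ ψf : ∀ x : G, (Fin n → Subgroup.centralizer ({x} : Set G)) → k,
      (∀ x ∈ X, (∀ i0 : Fin n, cSigma (fun _ => (1 : k)) i0 (ψf x) = ψf x) ∧
        cDiff (fun _ => (1 : k)) (ψf x) = 0) →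
      ∃ φ : (Fin n → G) → (G → k),
        (∀ i0 : Fin n,
          hSigma (fun _ _ => (1 : kˣ)) (Lmul fun _ _ => (1 : kˣ)) (Rmul fun _ _ => (1 : kˣ)) i0 φ = φ) ∧
        hDiff (fun _ _ => (1 : kˣ)) (Lmul fun _ _ => (1 : kˣ)) (Rmul fun _ _ => (1 : kˣ)) φ = 0 ∧
        ∀ x ∈ X, IsCSCoboundary (fun _ => (1 : k))
          (piC (fun _ _ => (1 : kˣ)) x φ - ψf x)) := by
  have hpi : ∀ ψf : ∀ x : G, (Fin n → Subgroup.centralizer ({x} : Set G)) → k, ∀ x ∈ X,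
      piC (fun _ _ => (1 : kˣ)) x
        (∑ y ∈ X, nuT y (γ y) (idx y) (rep y) (hrep y) (ψf y)) = ψf x := by
    intro ψf x hx
    rw [piC_sum, Finset.sum_eq_single x]
    · exact piC_nuT_self (hidx x) (hcover x) (hm x) (hγ1 x) (ψf x)
    · exact fun y hy hyx => piC_nuT_of_not_isConj
        (fun h => hyx ((hX x).unique ⟨hy, h⟩ ⟨hx, IsConj.refl x⟩)) _
    · exact fun h => absurd hx h
  refine ⟨fun x ψ hψ i => ?_, fun x φ hφ i => ?_, fun x => ⟨fun ψ _ hd => ?_, ?_⟩,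
    fun x => ⟨fun φ _ hd => ?_, ?_⟩, fun ψf _ hb x hx => ?_, fun ψf _ x hx => ?_,
    fun ψf hψ => ⟨∑ y ∈ X, nuT y (γ y) (idx y) (rep y) (hrep y) (ψf y), fun i => ?_, ?_,
      fun x hx => ?_⟩⟩
  · rw [hSigma_nuT (hidx x) (hcover x), hψ i]
  · rw [cSigma_piC, hφ i]
  · rw [hDiff_nuT (hidx x) (hcover x), hd, nuT_zero]
  · intro ψ ψ' _ _ _ _ hb
    rw [nuT_sub]
    exact IsCSCoboundary.nuT (hidx x) (hcover x) hb
  · rw [cDiff_piC, hd, piC_zero]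
  · intro φ φ' _ _ _ _ hb
    rw [piC_sub]
    exact hb.piC x
  · rw [← hpi ψf x hx]
    exact hb.piC x
  · rw [hpi ψf x hx, sub_self]
    exact isCSCoboundary_zero _
  · rw [hSigma_sum]
    exact Finset.sum_congr rfl fun y hy => by
      rw [hSigma_nuT (hidx y) (hcover y), (hψ y hy).1 i]
  · rw [hDiff_sum]
    exact Finset.sum_eq_zero fun y hy => by
      rw [hDiff_nuT (hidx y) (hcover y), (hψ y hy).2, nuT_zero]
  · rw [hpi ψf x hx, sub_self]
    exact isCSCoboundary_zero _

end TwistedSym
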